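/- Every element of R_n of the form 1 + a with a ∈ I is a unit, the set {u ∈ R_nˣ : u − 1 ∈ I} is a subgroup of the group of units R_nˣ, and this subgroup is nilpotent of nilpotency class at most n. -/

import Mathlib

def badRel (n : ℕ) (a b : FreeAlgebra ℤ (Fin n)) : Prop :=
  b = 0 ∧ ∃ l : List (Fin n), ¬ l.Nodup ∧ a = (l.map (FreeAlgebra.ι ℤ)).prod

abbrev Rring (n : ℕ) := RingQuot (badRel n)

def Xgen (n : ℕ) (i : Fin n) : Rring n :=
  RingQuot.mkRingHom (badRel n) (FreeAlgebra.ι ℤ i)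

def Iideal (n : ℕ) : Submodule ℤ (Rring n) :=
  Submodule.span ℤ {y | ∃ a b : Rring n, ∃ i : Fin n, y = a * Xgen n i * b}

/-- The subgroup of `R_n` spanned by the words of length at least `k` in the generators. -/
def wordFiltration (n k : ℕ) : Submodule ℤ (Rring n) :=
  Submodule.span ℤ {y | ∃ l : List (Fin n), k ≤ l.length ∧ y = (l.map (Xgen n)).prod}

theorem word_mem_wordFiltration {n k : ℕ} (l : List (Fin n)) (hl : k ≤ l.length) :
    (l.map (Xgen n)).prod ∈ wordFiltration n k :=
  Submodule.subset_span ⟨l, hl, rfl⟩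

theorem mul_mem_wordFiltration {n j k : ℕ} {a b : Rring n} (ha : a ∈ wordFiltration n j)
    (hb : b ∈ wordFiltration n k) : a * b ∈ wordFiltration n (j + k) := by
  induction ha using Submodule.span_induction with
  | zero => rw [zero_mul]; exact zero_mem _
  | add x y _ _ hx hy => rw [add_mul]; exact add_mem hx hy
  | smul r x _ hx => rw [smul_mul_assoc]; exact Submodule.smul_mem _ r hx
  | mem x hx =>
    obtain ⟨l, hl, rfl⟩ := hx
    induction hb using Submodule.span_induction with
    | zero => rw [mul_zero]; exact zero_mem _
    | add x y _ _ hx hy => rw [mul_add]; exact add_mem hx hy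
    | smul r x _ hx => rw [mul_smul_comm]; exact Submodule.smul_mem _ r hx
    | mem x hx =>
      obtain ⟨m, hm, rfl⟩ := hx
      rw [← List.prod_append, ← List.map_append]
      exact word_mem_wordFiltration _ (by rw [List.length_append]; omega)

theorem mem_wordFiltration_zero {n : ℕ} (a : Rring n) : a ∈ wordFiltration n 0 := by
  have hone : (1 : Rring n) ∈ wordFiltration n 0 :=
    word_mem_wordFiltration (k := 0) [] le_rfl
  obtain ⟨a, rfl⟩ := RingQuot.mkRingHom_surjective (badRel n) a
  induction a using FreeAlgebra.induction with
  | grade0 r =>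
    rw [eq_intCast, map_intCast, ← zsmul_one]
    exact zsmul_mem hone r
  | grade1 i => simpa [Xgen] using word_mem_wordFiltration (k := 0) [i] (Nat.zero_le _)
  | mul a b ha hb =>
    have h := mul_mem_wordFiltration ha hb
    rwa [add_zero, ← map_mul] at h
  | add a b ha hb => rw [map_add]; exact add_mem ha hb

theorem mul_mem_wordFiltration_left {n k : ℕ} {a : Rring n} (ha : a ∈ wordFiltration n k)
    (b : Rring n) : a * b ∈ wordFiltration n k := by
  have h := mul_mem_wordFiltration ha (mem_wordFiltration_zero b)
  rwa [add_zero] at h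

theorem wordFiltration_eq_bot (n : ℕ) : wordFiltration n (n + 1) = ⊥ := by
  refine Submodule.span_eq_bot.2 ?_
  rintro _ ⟨l, hl, rfl⟩
  have hdup : ¬ l.Nodup := fun h => by
    have := h.length_le_card
    rw [Fintype.card_fin] at this
    omega
  have h := RingQuot.mkRingHom_rel (r := badRel n) ⟨rfl, l, hdup, rfl⟩
  rw [map_zero, map_list_prod, List.map_map] at h
  exact h

theorem Iideal_eq_wordFiltration_one (n : ℕ) : Iideal n = wordFiltration n 1 := by
  refine le_antisymm (Submodule.span_le.2 ?_) (Submodule.span_le.2 ?_)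
  · rintro _ ⟨a, b, i, rfl⟩
    have hX : Xgen n i ∈ wordFiltration n 1 := by
      simpa using word_mem_wordFiltration (k := 1) [i] le_rfl
    have h := mul_mem_wordFiltration (mem_wordFiltration_zero a) hX
    rw [zero_add] at h
    exact mul_mem_wordFiltration_left h b
  · rintro _ ⟨_ | ⟨i, l⟩, hl, rfl⟩
    · simp at hl
    · exact Submodule.subset_span ⟨1, (l.map (Xgen n)).prod, i, by simp⟩

theorem pow_mem_wordFiltration {n : ℕ} {a : Rring n} (ha : a ∈ wordFiltration n 1) (k : ℕ) :
    a ^ k ∈ wordFiltration n k := by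
  induction k with
  | zero => exact mem_wordFiltration_zero _
  | succ k ih => rw [pow_succ]; exact mul_mem_wordFiltration ih ha

/-- The units of `R_n` congruent to `1` modulo words of length at least `k`. -/
def congruenceUnits (n k : ℕ) : Subgroup (Rring n)ˣ where
  carrier := {u | (u : Rring n) - 1 ∈ wordFiltration n k}
  one_mem' := by simp
  mul_mem' := by
    intro u v hu hv
    have h : ((u * v : (Rring n)ˣ) : Rring n) - 1 = ((u : Rring n) - 1) * v + (v - 1) := by
      rw [Units.val_mul, sub_mul, one_mul, sub_add_sub_cancel]
    rw [Set.mem_ofPred_eq, h]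
    exact add_mem (mul_mem_wordFiltration_left hu _) hv
  inv_mem' := by
    intro u hu
    have h : ((u⁻¹ : (Rring n)ˣ) : Rring n) - 1 = -(((u : Rring n) - 1) * ↑u⁻¹) := by
      rw [sub_mul, Units.mul_inv, one_mul, neg_sub]
    rw [Set.mem_ofPred_eq, h]
    exact neg_mem (mul_mem_wordFiltration_left hu _)

theorem mem_congruenceUnits {n k : ℕ} {u : (Rring n)ˣ} :
    u ∈ congruenceUnits n k ↔ (u : Rring n) - 1 ∈ wordFiltration n k :=
  Iff.rfl

theorem congruenceUnits_eq_bot (n : ℕ) : congruenceUnits n (n + 1) = ⊥ := by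
  refine (Subgroup.eq_bot_iff_forall _).2 fun u hu => ?_
  rw [mem_congruenceUnits, wordFiltration_eq_bot, Submodule.mem_bot, sub_eq_zero] at hu
  exact Units.ext hu

theorem commutator_mem_congruenceUnits {n j k : ℕ} {u v : (Rring n)ˣ}
    (hu : u ∈ congruenceUnits n j) (hv : v ∈ congruenceUnits n k) :
    u * v * u⁻¹ * v⁻¹ ∈ congruenceUnits n (j + k) := by
  have h : ((u * v * u⁻¹ * v⁻¹ : (Rring n)ˣ) : Rring n) - 1 =
      (((u : Rring n) - 1) * (v - 1) - (v - 1) * (u - 1)) * ((u⁻¹ * v⁻¹ : (Rring n)ˣ) : Rring n) := by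
    have hvu : (v : Rring n) * u * ((u⁻¹ * v⁻¹ : (Rring n)ˣ) : Rring n) = 1 := by
      rw [← Units.val_mul, ← Units.val_mul, ← mul_inv_rev, mul_inv_cancel, Units.val_one]
    have hcomm : ((u : Rring n) - 1) * (v - 1) - (v - 1) * (u - 1) = u * v - v * u := by
      simp only [sub_mul, mul_sub, one_mul, mul_one]
      abel
    rw [hcomm, sub_mul, hvu, mul_assoc (u * v), Units.val_mul, Units.val_mul u v]
  rw [mem_congruenceUnits, h]
  refine mul_mem_wordFiltration_left (sub_mem (mul_mem_wordFiltration hu hv) ?_) _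
  rw [add_comm]
  exact mul_mem_wordFiltration hv hu

theorem lowerCentralSeries_congruenceUnits_le (n k : ℕ) :
    (congruenceUnits n 1).lowerCentralSeries k ≤ congruenceUnits n (k + 1) := by
  induction k with
  | zero => exact le_rfl
  | succ k ih =>
    exact Subgroup.commutator_le.2 fun u hu v hv => commutator_mem_congruenceUnits (ih hu) hv

/-- Every `1 + a` with `a ∈ I` is a unit of `R_n`, the set
`{u ∈ R_nˣ : u − 1 ∈ I}` is a subgroup of `R_nˣ`, and this subgroup is nilpotent of
nilpotency class at most `n` (i.e. the `(n+1)`-st lower central series term, which is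
`lowerCentralSeries _ n` in Mathlib's indexing, is trivial). -/
theorem units_one_add_ideal_nilpotent (n : ℕ) (hn : 1 ≤ n) :
    (∀ a ∈ Iideal n, IsUnit (1 + a)) ∧
    ∃ H : Subgroup (Rring n)ˣ,
      (H : Set (Rring n)ˣ) = {u : (Rring n)ˣ | (↑u : Rring n) - 1 ∈ Iideal n} ∧
      Group.IsNilpotent H ∧ lowerCentralSeries H n = ⊥ := by
  have hbot : (congruenceUnits n 1).lowerCentralSeries n = ⊥ :=
    le_bot_iff.1 ((lowerCentralSeries_congruenceUnits_le n n).trans_eq (congruenceUnits_eq_bot n))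
  refine ⟨fun a ha => ?_, congruenceUnits n 1, ?_, ?_, hbot⟩
  · rw [Iideal_eq_wordFiltration_one] at ha
    have h := pow_mem_wordFiltration ha (n + 1)
    rw [wordFiltration_eq_bot, Submodule.mem_bot] at h
    exact IsNilpotent.isUnit_one_add ⟨n + 1, h⟩
  · rw [Iideal_eq_wordFiltration_one]
    rfl
  · exact (Subgroup.isNilpotent_iff_lowerCentralSeries _).2 ⟨n, hbot⟩
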